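/- For every integer n ≥ 2, every decision tree over the index set P_n that computes the 2-reachability function f_n has size (number of leaves) at least (3/2)^{n−2}. In particular, the minimum size of a decision tree computing f_n grows exponentially in n. -/

import Mathlib

/-- Decision trees over an index set `ι`: a leaf labeled by a bit, or an internal node
querying index `i` with subtrees `t₀` (taken when `x i = 0`) and `t₁` (when `x i = 1`). -/
inductive DTree (ι : Type*) where
  | leaf : Bool → DTree ι
  | node : ι → DTree ι → DTree ι → DTree ι

/-- Evaluation of a decision tree on an input. -/
def DTree.eval {ι : Type*} : DTree ι → (ι → Bool) → Bool
  | .leaf b, _ => b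
  | .node i t0 t1, x => if x i then t1.eval x else t0.eval x

/-- Size of a decision tree: number of leaves. -/
def DTree.size {ι : Type*} : DTree ι → ℕ
  | .leaf _ => 1
  | .node _ t0 t1 => t0.size + t1.size

/-- `P_n`: unordered pairs of distinct elements of the `n`-element vertex set. -/
abbrev EdgeIx (n : ℕ) := {p : Sym2 (Fin n) // ¬ p.IsDiag}

/-- Read an assignment `x : P_n → {0,1}` at an arbitrary unordered pair. -/
def xe {n : ℕ} (x : EdgeIx n → Bool) (p : Sym2 (Fin n)) : Bool :=
  if h : p.IsDiag then false else x ⟨p, h⟩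

/-- Vertex `1`. -/
def vone (n : ℕ) (hn : 2 ≤ n) : Fin n := ⟨0, by omega⟩

/-- Vertex `n`. -/
def vlast (n : ℕ) (hn : 2 ≤ n) : Fin n := ⟨n - 1, by omega⟩

/-- The 2-reachability function `f_n`. -/
def fReach (n : ℕ) (hn : 2 ≤ n) (x : EdgeIx n → Bool) : Bool :=
  xe x s(vone n hn, vlast n hn) ||
    decide (∃ v : Fin n, v ≠ vone n hn ∧ v ≠ vlast n hn ∧
      xe x s(vone n hn, v) = true ∧ xe x s(v, vlast n hn) = true)

/-- If any two distinct members of a family of inputs can be mixed into an input on which `T`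
changes its value, then no two members reach the same leaf, so the family is at most as large
as the number of leaves. -/
theorem DTree.card_le_size {ι α : Type*} (T : DTree ι) (S : Finset α) (x : α → ι → Bool)
    (h : ∀ a ∈ S, ∀ b ∈ S, a ≠ b →
      ∃ z : ι → Bool, (∀ i, x a i = x b i → z i = x a i) ∧ T.eval z ≠ T.eval (x a)) :
    S.card ≤ T.size := by
  induction T generalizing S with
  | leaf c =>
    refine Finset.card_le_one.2 fun a ha b hb => ?_
    by_contra hab
    obtain ⟨z, -, hz⟩ := h a ha b hb hab
    exact hz rfl
  | node i t0 t1 ih0 ih1 =>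
    rw [← Finset.card_filter_add_card_filter_not (s := S) (fun a => x a i = false)]
    refine add_le_add (ih0 _ ?_) (ih1 _ ?_)
    all_goals
      intro a ha b hb hab
      simp only [Finset.mem_filter, Bool.not_eq_false] at ha hb
      obtain ⟨z, hz, hne⟩ := h a ha.1 b hb.1 hab
      refine ⟨z, hz, ?_⟩
      have hzi := hz i (ha.2.trans hb.2.symm)
      simpa [DTree.eval, hzi, ha.2] using hne

/-- The graph in which every vertex `v` other than `1` and `n` is joined to `1` if `v ∈ A`
and to `n` otherwise. -/
def splitGraph (n : ℕ) (hn : 2 ≤ n) (A : Finset (Fin n)) (e : EdgeIx n) : Bool :=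
  decide (∃ v : Fin n, v ≠ vone n hn ∧ v ≠ vlast n hn ∧
    ((e.1 = s(vone n hn, v) ∧ v ∈ A) ∨ (e.1 = s(v, vlast n hn) ∧ v ∉ A)))

theorem vone_ne_vlast (n : ℕ) (hn : 2 ≤ n) : vone n hn ≠ vlast n hn := by
  simp only [vone, vlast, ne_eq, Fin.mk.injEq]
  omega

section
variable {n : ℕ} {hn : 2 ≤ n} {v : Fin n}

theorem xe_splitGraph_vone (A : Finset (Fin n)) (h1 : v ≠ vone n hn) (h2 : v ≠ vlast n hn) :
    xe (splitGraph n hn A) s(vone n hn, v) = decide (v ∈ A) := by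
  have := vone_ne_vlast n hn
  simp only [xe, splitGraph, Sym2.mk_isDiag_iff, Sym2.eq_iff]
  grind

theorem xe_splitGraph_vlast (A : Finset (Fin n)) (h1 : v ≠ vone n hn) (h2 : v ≠ vlast n hn) :
    xe (splitGraph n hn A) s(v, vlast n hn) = decide (v ∉ A) := by
  have := vone_ne_vlast n hn
  simp only [xe, splitGraph, Sym2.mk_isDiag_iff, Sym2.eq_iff]
  grind

theorem xe_splitGraph_vone_vlast (A : Finset (Fin n)) :
    xe (splitGraph n hn A) s(vone n hn, vlast n hn) = false := by
  have := vone_ne_vlast n hn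
  simp only [xe, splitGraph, Sym2.mk_isDiag_iff, Sym2.eq_iff]
  grind

theorem fReach_splitGraph (A : Finset (Fin n)) : fReach n hn (splitGraph n hn A) = false := by
  simp only [fReach, xe_splitGraph_vone_vlast, Bool.false_or, decide_eq_false_iff_not]
  rintro ⟨v, h1, h2, h3, h4⟩
  rw [xe_splitGraph_vone A h1 h2] at h3
  rw [xe_splitGraph_vlast A h1 h2] at h4
  simp_all

theorem xe_or (x y : EdgeIx n → Bool) (p : Sym2 (Fin n)) :
    xe (fun e => x e || y e) p = (xe x p || xe y p) := by
  unfold xe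
  split <;> rfl

theorem fReach_or_splitGraph {A B : Finset (Fin n)} (h1 : v ≠ vone n hn) (h2 : v ≠ vlast n hn)
    (hv : ¬(v ∈ A ↔ v ∈ B)) :
    fReach n hn (fun e => splitGraph n hn A e || splitGraph n hn B e) = true := by
  simp only [fReach, Bool.or_eq_true, decide_eq_true_eq]
  refine Or.inr ⟨v, h1, h2, ?_⟩
  simp only [xe_or, xe_splitGraph_vone _ h1 h2, xe_splitGraph_vlast _ h1 h2, Bool.or_eq_true,
    decide_eq_true_eq]
  tauto

end

/-- A decision tree computing `f_n` has at least `2 ^ (n - 2)` leaves. -/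
theorem two_pow_le_size (n : ℕ) (hn : 2 ≤ n) (T : DTree (EdgeIx n))
    (hcomp : ∀ x : EdgeIx n → Bool, T.eval x = fReach n hn x) : 2 ^ (n - 2) ≤ T.size := by
  have key := T.card_le_size ({vone n hn, vlast n hn}ᶜ : Finset (Fin n)).powerset
    (splitGraph n hn) ?_
  · rwa [Finset.card_powerset, Finset.card_compl, Finset.card_pair (vone_ne_vlast n hn),
      Fintype.card_fin] at key
  · intro A hA B hB hAB
    obtain ⟨v, hv⟩ : ∃ v, ¬(v ∈ A ↔ v ∈ B) := by
      by_contra! h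
      exact hAB (Finset.ext h)
    have hmid : v ∈ ({vone n hn, vlast n hn}ᶜ : Finset (Fin n)) := by
      rw [Finset.mem_powerset] at hA hB
      by_cases hvA : v ∈ A
      · exact hA hvA
      · exact hB (by tauto)
    simp only [Finset.mem_compl, Finset.mem_insert, Finset.mem_singleton, not_or] at hmid
    refine ⟨fun e => splitGraph n hn A e || splitGraph n hn B e, fun e he => by simp [he], ?_⟩
    rw [hcomp, hcomp, fReach_splitGraph, fReach_or_splitGraph hmid.1 hmid.2 hv]
    decide

/-- Every decision tree over `P_n` computing the 2-reachability function `f_n`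
has at least `(3/2) ^ (n−2)` leaves; in particular its size is exponential in `n`. -/
theorem dtree_size_lower_bound (n : ℕ) (hn : 2 ≤ n) (T : DTree (EdgeIx n))
    (hcomp : ∀ x : EdgeIx n → Bool, T.eval x = fReach n hn x) :
    ((3 : ℝ) / 2) ^ (n - 2) ≤ (T.size : ℝ) := by
  calc ((3 : ℝ) / 2) ^ (n - 2) ≤ 2 ^ (n - 2) := by gcongr; norm_num
    _ ≤ (T.size : ℝ) := by exact_mod_cast two_pow_le_size n hn T hcomp
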